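/- arXiv:2203.03395 — 3 statements merged into one kernel-verified Lean document; each statement's English description precedes it below -/
import Mathlib

section
/- For every natural number n and every real t, define L(t) := (−1)ⁿ ∫₀¹ sin(u·t)·T_{2n}(u)/√(1−u²) du, where T_{2n} is the Chebyshev polynomial of the first kind of degree 2n. Then L satisfies the Fourier-inversion identity: for all u with 0 < u < 1, (2/π)·∫₀^∞ sin(u·t)·L(t) dt = (−1)ⁿ · T_{2n}(u)/√(1−u²) (the improper integral interpreted as the limit of ∫₀^R as R → ∞). -/
open Real Polynomial Filter

open MeasureTheory Topology

/-- **Riemann–Lebesgue lemma** for the sine transform. -/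
theorem tendsto_integral_sin_mul_atTop {f : ℝ → ℝ} (hf : Integrable f) :
    Tendsto (fun R : ℝ => ∫ v, Real.sin (R * v) * f v) atTop (𝓝 0) := by
  have hR : Tendsto (fun R : ℝ => R * (-(2 * π)⁻¹)) atTop (cocompact ℝ) :=
    (tendsto_id.atTop_mul_const_of_neg (by simp [Real.pi_pos])).mono_right atBot_le_cocompact
  have h := (Complex.continuous_im.tendsto 0).comp
    ((Real.tendsto_integral_exp_smul_cocompact (fun v => (f v : ℂ))).comp hR)
  refine h.congr fun R => ?_
  simp only [Function.comp_apply]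
  rw [← RCLike.im_eq_complex_im, ← integral_im]
  · refine integral_congr_ae (ae_of_all _ fun v => ?_)
    have hv : 2 * π * -(v * (R * -(2 * π)⁻¹)) = R * v := by
      field_simp
    simp only [Circle.smul_def, Real.fourierChar_apply, hv, RCLike.im_eq_complex_im, smul_eq_mul,
      Complex.im_mul_ofReal, Complex.exp_ofReal_mul_I_im]
  · have := (Real.fourierIntegral_convergent_iff (f := fun v => (f v : ℂ)) (μ := volume)
      (R * -(2 * π)⁻¹)).2 hf.ofReal
    refine this.congr (ae_of_all _ fun v => ?_)
    simp [mul_comm]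

theorem integrable_div_self_of_differentiableAt {f : ℝ → ℝ} (hf : Integrable f)
    (hd : DifferentiableAt ℝ f 0) (h0 : f 0 = 0) : Integrable (fun v => f v / v) := by
  obtain ⟨C, hC⟩ := hd.isBigO_sub.bound
  obtain ⟨δ, hδ, hball⟩ := Metric.eventually_nhds_iff_ball.1 hC
  have hind : Integrable ((Metric.ball (0 : ℝ) δ).indicator fun _ => |C|) :=
    (integrable_indicator_iff measurableSet_ball).2
      (integrableOn_const measure_ball_lt_top.ne)
  refine (hind.add (hf.norm.div_const δ)).mono'
    (hf.aestronglyMeasurable.aemeasurable.div aemeasurable_id).aestronglyMeasurable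
    (ae_of_all _ fun v => ?_)
  simp only [Pi.add_apply, norm_div]
  by_cases hv : v ∈ Metric.ball (0 : ℝ) δ
  · rw [Set.indicator_of_mem hv]
    have h1 := hball v hv
    simp only [h0, sub_zero] at h1
    have h2 : ‖f v‖ / ‖v‖ ≤ |C| := by
      refine div_le_of_le_mul₀ (norm_nonneg _) (abs_nonneg _) (h1.trans ?_)
      gcongr
      exact le_abs_self C
    have : 0 ≤ ‖f v‖ / δ := by positivity
    linarith
  · rw [Set.indicator_of_notMem hv, zero_add]
    have hv' : δ ≤ ‖v‖ := by simpa using hv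
    gcongr

theorem integrable_mul_cos {α : Type*} [MeasurableSpace α] {μ : Measure α} {f φ : α → ℝ}
    (hf : Integrable f μ) (hφ : Measurable φ) : Integrable (fun v => f v * Real.cos (φ v)) μ := by
  refine hf.mono (hf.aestronglyMeasurable.mul (by fun_prop)) (ae_of_all _ fun v => ?_)
  rw [norm_mul]
  exact mul_le_of_le_one_right (norm_nonneg _) (Real.abs_cos_le_one _)

theorem continuous_integral_mul_cos {f : ℝ → ℝ} (hf : Integrable f) :
    Continuous fun t : ℝ => ∫ v, f v * Real.cos (t * v) := by
  refine continuous_of_dominated (bound := fun v => ‖f v‖) (fun t => ?_)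
    (fun t => ae_of_all _ fun v => ?_) hf.norm (ae_of_all _ fun v => by fun_prop)
  · exact hf.aestronglyMeasurable.mul (by fun_prop)
  · rw [norm_mul]
    exact mul_le_of_le_one_right (norm_nonneg _) (Real.abs_cos_le_one _)

theorem intervalIntegral_integral_mul_cos {f : ℝ → ℝ} (hf : Integrable f) (R : ℝ) :
    ∫ t in (0 : ℝ)..R, ∫ v, f v * Real.cos (t * v) = ∫ v, f v * ∫ t in (0 : ℝ)..R,
      Real.cos (t * v) := by
  rw [intervalIntegral_integral_swap]
  · simp_rw [intervalIntegral.integral_const_mul]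
  · have : IsFiniteMeasure (volume.restrict (Set.uIoc 0 R)) := ⟨by
      rw [Measure.restrict_apply_univ, Set.uIoc, Real.volume_Ioc]
      exact ENNReal.ofReal_lt_top⟩
    have h1 : Integrable (fun p : ℝ × ℝ => f p.2)
        ((volume.restrict (Set.uIoc 0 R)).prod volume) := hf.comp_snd _
    exact integrable_mul_cos h1 (by fun_prop)

theorem integral_exp_neg_sq_mul_cos (t : ℝ) :
    ∫ v : ℝ, Real.exp (-v ^ 2) * Real.cos (t * v) = √π * Real.exp (-(1 / 4) * t ^ 2) := by
  have h := congrArg Complex.re (fourierIntegral_gaussian (b := 1) (by simp) t)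
  have hr : ((π : ℂ) / 1) ^ (1 / 2 : ℂ) * Complex.exp (-(t : ℂ) ^ 2 / (4 * 1))
      = ((√π * Real.exp (-(1 / 4) * t ^ 2) : ℝ) : ℂ) := by
    rw [Real.sqrt_eq_rpow, Complex.ofReal_mul, Complex.ofReal_cpow Real.pi_pos.le,
      Complex.ofReal_exp]
    push_cast
    congr 2
    · simp
    · ring
  rw [hr, Complex.ofReal_re, ← RCLike.re_eq_complex_re, ← integral_re] at h
  · rw [← h]
    refine integral_congr_ae (ae_of_all _ fun v => ?_)
    have e1 : Complex.exp (Complex.I * t * v) = Complex.exp ((t * v : ℝ) * Complex.I) := by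
      push_cast
      ring_nf
    have e2 : Complex.exp (-1 * (v : ℂ) ^ 2) = (Real.exp (-v ^ 2) : ℝ) := by
      push_cast
      ring_nf
    simp only [RCLike.re_eq_complex_re]
    rw [e1, e2, Complex.re_mul_ofReal, Complex.exp_ofReal_mul_I_re, mul_comm]
  · refine (integrable_cexp_quadratic (b := 1) (by simp) (Complex.I * t) 0).congr
      (ae_of_all _ fun v => ?_)
    simp only [← Complex.exp_add]
    ring_nf

theorem tendsto_integral_integral_exp_neg_sq_mul_cos :
    Tendsto (fun R : ℝ => ∫ t in (0 : ℝ)..R, ∫ v : ℝ, Real.exp (-v ^ 2) * Real.cos (t * v))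
      atTop (𝓝 π) := by
  simp_rw [integral_exp_neg_sq_mul_cos]
  have hi : Integrable fun t : ℝ => √π * Real.exp (-(1 / 4) * t ^ 2) :=
    (integrable_exp_neg_mul_sq (by norm_num)).const_mul _
  have h := intervalIntegral_tendsto_integral_Ioi 0 hi.integrableOn tendsto_id
  rw [integral_const_mul, integral_gaussian_Ioi] at h
  convert! h using 2
  rw [show π / (1 / 4) = π * 2 ^ 2 by ring, Real.sqrt_mul Real.pi_pos.le,
    Real.sqrt_sq zero_le_two]
  have := Real.mul_self_sqrt Real.pi_pos.le
  linear_combination -this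

/-- Fourier inversion for the cosine transform at the origin, assuming differentiability there. -/
theorem tendsto_integral_integral_mul_cos_zero {f : ℝ → ℝ} (hf : Integrable f)
    (hd : DifferentiableAt ℝ f 0) :
    Tendsto (fun R : ℝ => ∫ t in (0 : ℝ)..R, ∫ v, f v * Real.cos (t * v)) atTop
      (𝓝 (π * f 0)) := by
  have hexp : Integrable fun v : ℝ => Real.exp (-v ^ 2) := by
    simpa using integrable_exp_neg_mul_sq one_pos
  have hg : Integrable fun v => f v - f 0 * Real.exp (-v ^ 2) := hf.sub (hexp.const_mul _)
  have hH := integrable_div_self_of_differentiableAt hg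
    (hd.sub (by fun_prop)) (by simp)
  have key := (tendsto_integral_sin_mul_atTop hH).add
    (tendsto_integral_integral_exp_neg_sq_mul_cos.const_mul (f 0))
  rw [zero_add, mul_comm] at key
  refine key.congr fun R => ?_
  have h1 : ∫ v, Real.sin (R * v) * ((f v - f 0 * Real.exp (-v ^ 2)) / v)
      = ∫ t in (0 : ℝ)..R, ∫ v, (f v - f 0 * Real.exp (-v ^ 2)) * Real.cos (t * v) := by
    rw [intervalIntegral_integral_mul_cos hg]
    refine integral_congr_ae (ae_of_all _ fun v => ?_)
    rcases eq_or_ne v 0 with rfl | hv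
    · simp
    · simp only [intervalIntegral.integral_comp_mul_right _ hv, integral_cos, zero_mul,
        Real.sin_zero, sub_zero, smul_eq_mul]
      ring
  rw [h1, ← intervalIntegral.integral_const_mul, ← intervalIntegral.integral_add
    ((continuous_integral_mul_cos hg).intervalIntegrable _ _)
    (((continuous_integral_mul_cos hexp).const_mul _).intervalIntegrable _ _)]
  refine intervalIntegral.integral_congr fun t _ => ?_
  rw [← integral_const_mul, ← integral_add (integrable_mul_cos hg (by fun_prop))
    ((integrable_mul_cos hexp (by fun_prop)).const_mul _)]
  refine integral_congr_ae (ae_of_all _ fun v => ?_)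
  ring

/-- Fourier inversion for the cosine transform at a point of differentiability. -/
theorem tendsto_integral_integral_mul_cos {f : ℝ → ℝ} (hf : Integrable f) {u : ℝ}
    (hd : DifferentiableAt ℝ f u) :
    Tendsto (fun R : ℝ => ∫ t in (0 : ℝ)..R, ∫ v, f v * Real.cos (t * (v - u))) atTop
      (𝓝 (π * f u)) := by
  have hd' : DifferentiableAt ℝ (fun v => f (v + u)) 0 := by
    rw [differentiableAt_comp_add_const, zero_add]
    exact hd
  have h := tendsto_integral_integral_mul_cos_zero (hf.comp_add_right u) hd'
  rw [zero_add] at h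
  refine h.congr fun R => intervalIntegral.integral_congr fun t _ => ?_
  simpa using integral_add_right_eq_self (fun v => f v * Real.cos (t * (v - u))) u

theorem continuous_integral_mul_cos_sub {f : ℝ → ℝ} (hf : Integrable f) (u : ℝ) :
    Continuous fun t : ℝ => ∫ v, f v * Real.cos (t * (v - u)) := by
  refine (continuous_integral_mul_cos (hf.comp_add_right u)).congr fun t => ?_
  simpa using integral_add_right_eq_self (fun v => f v * Real.cos (t * (v - u))) u

/-- Fourier inversion for the sine transform of a function that is differentiable at `u` and
at `-u`. -/
theorem tendsto_integral_sin_mul_integral_sin {f : ℝ → ℝ} (hf : Integrable f) {u : ℝ}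
    (hu : DifferentiableAt ℝ f u) (hu' : DifferentiableAt ℝ f (-u)) :
    Tendsto (fun R : ℝ => ∫ t in (0 : ℝ)..R, Real.sin (u * t) * ∫ v, Real.sin (v * t) * f v)
      atTop (𝓝 (π / 2 * (f u - f (-u)))) := by
  have h := ((tendsto_integral_integral_mul_cos hf hu).sub
    (tendsto_integral_integral_mul_cos hf hu')).const_mul (1 / 2)
  rw [show 1 / 2 * (π * f u - π * f (-u)) = π / 2 * (f u - f (-u)) by ring] at h
  refine h.congr fun R => ?_
  rw [← intervalIntegral.integral_sub
    ((continuous_integral_mul_cos_sub hf _).intervalIntegrable _ _)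
    ((continuous_integral_mul_cos_sub hf _).intervalIntegrable _ _),
    ← intervalIntegral.integral_const_mul]
  refine intervalIntegral.integral_congr fun t _ => ?_
  rw [← integral_sub (integrable_mul_cos hf (by fun_prop))
    (integrable_mul_cos hf (by fun_prop)), ← integral_const_mul, ← integral_const_mul]
  refine integral_congr_ae (ae_of_all _ fun v => ?_)
  beta_reduce
  rw [show t * (v - u) = v * t - u * t by ring, show t * (v - -u) = v * t + u * t by ring,
    Real.cos_sub, Real.cos_add]
  ring

theorem stmt2 (n : ℕ)
    (L : ℝ → ℝ)
    (hL : ∀ t : ℝ, L t = (-1 : ℝ) ^ n *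
      ∫ u in (0:ℝ)..1, Real.sin (u * t) * (Polynomial.Chebyshev.T ℝ (2 * n)).eval u /
        Real.sqrt (1 - u ^ 2)) :
    ∀ u : ℝ, 0 < u → u < 1 →
      Tendsto (fun R : ℝ => (2 / Real.pi) * ∫ t in (0:ℝ)..R, Real.sin (u * t) * L t) atTop
        (nhds ((-1 : ℝ) ^ n * (Polynomial.Chebyshev.T ℝ (2 * n)).eval u /
          Real.sqrt (1 - u ^ 2))) := by
  intro u hu0 hu1
  set T := Polynomial.Chebyshev.T ℝ (2 * n)
  set g : ℝ → ℝ := fun v => T.eval v / √(1 - v ^ 2) with hg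
  set f : ℝ → ℝ := (Set.Ioc (0 : ℝ) 1).indicator g with hf
  have hgi : IntegrableOn g (Set.Ioc 0 1) := by
    have h := Polynomial.Chebyshev.intervalIntegrable_sqrt_one_sub_sq_inv.continuousOn_mul
      T.continuous.continuousOn
    rw [intervalIntegrable_iff_integrableOn_Ioc_of_le (by norm_num)] at h
    simpa only [hg, div_eq_mul_inv, IntegrableOn, IntervalIntegrable, Real.sqrt_inv] using
      h.mono_set (Set.Ioc_subset_Ioc_left (show (-1 : ℝ) ≤ 0 by norm_num))
  have hfi : Integrable f := (integrable_indicator_iff measurableSet_Ioc).2 hgi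
  have hfu : f u = g u := Set.indicator_of_mem (show u ∈ Set.Ioc 0 1 from ⟨hu0, hu1.le⟩) _
  have hfu' : f (-u) = 0 := Set.indicator_of_notMem (fun h => by linarith [h.1]) _
  have hd : DifferentiableAt ℝ f u := by
    have hpos : 0 < 1 - u ^ 2 := by nlinarith
    have hdg : DifferentiableAt ℝ g u :=
      T.differentiableAt.div (DifferentiableAt.sqrt (by fun_prop) hpos.ne')
        (Real.sqrt_pos.2 hpos).ne'
    refine hdg.congr_of_eventuallyEq ?_
    filter_upwards [Ioo_mem_nhds hu0 hu1] with v hv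
    exact Set.indicator_of_mem (show v ∈ Set.Ioc 0 1 from ⟨hv.1, hv.2.le⟩) _
  have hd' : DifferentiableAt ℝ f (-u) := by
    refine (differentiableAt_const 0).congr_of_eventuallyEq ?_
    filter_upwards [Iio_mem_nhds (neg_lt_zero.2 hu0)] with v hv
    exact Set.indicator_of_notMem (fun h => lt_asymm hv h.1) _
  have h := (tendsto_integral_sin_mul_integral_sin hfi hd hd').const_mul (2 / π * (-1) ^ n)
  have hlim : 2 / π * (-1) ^ n * (π / 2 * (f u - f (-u))) = (-1) ^ n * T.eval u / √(1 - u ^ 2) := by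
    rw [hfu, hfu', hg]
    field_simp
    ring
  rw [hlim] at h
  refine h.congr fun R => ?_
  rw [mul_assoc, ← intervalIntegral.integral_const_mul]
  congr 1
  refine intervalIntegral.integral_congr fun t _ => ?_
  have hint : ∫ v, Real.sin (v * t) * f v =
      ∫ v in (0 : ℝ)..1, Real.sin (v * t) * T.eval v / √(1 - v ^ 2) := by
    rw [intervalIntegral.integral_of_le zero_le_one, ← integral_indicator measurableSet_Ioc]
    refine integral_congr_ae (ae_of_all _ fun v => ?_)
    by_cases hv : v ∈ Set.Ioc (0 : ℝ) 1 <;> simp [hf, hg, hv, mul_div_assoc]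
  simp only [hL, hint]
  ring
end

section
/- For every natural number n and every real t, the Lommel function satisfies s_{0,2n}(t) = (−1)ⁿ ∫₀¹ sin(u·t)·T_{2n}(u)/√(1−u²) du, where T_{2n} is the Chebyshev polynomial of the first kind. -/
open Real Polynomial

/-- Lommel function `s_{0,2n}(t)` via its hypergeometric series. -/
noncomputable def lommelS0even (n : ℕ) (t : ℝ) : ℝ :=
  t / (1 - (2 * (n : ℝ)) ^ 2) * ∑' k : ℕ, (-t ^ 2 / 4) ^ k /
    ((ascPochhammer ℝ k).eval ((3 - 2 * (n : ℝ)) / 2) *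
      (ascPochhammer ℝ k).eval ((3 + 2 * (n : ℝ)) / 2))

open Set MeasureTheory intervalIntegral

/-- The substitution `u = cos θ` on the first quadrant; no regularity of `f` is needed. -/
lemma integral_div_sqrt_one_sub_sq_eq_integral_cos (f : ℝ → ℝ) :
    ∫ u in (0 : ℝ)..1, f u / √(1 - u ^ 2) = ∫ θ in (0 : ℝ)..(π / 2), f (cos θ) := by
  have himg : cos '' Ioo 0 (π / 2) = Ioo 0 1 := by
    ext u
    constructor
    · rintro ⟨θ, ⟨h0, h1⟩, rfl⟩
      refine ⟨cos_pos_of_mem_Ioo ⟨by linarith, h1⟩, ?_⟩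
      simpa using cos_lt_cos_of_nonneg_of_le_pi_div_two le_rfl h1.le h0
    · rintro ⟨h0, h1⟩
      exact ⟨arccos u, ⟨arccos_pos.2 h1, arccos_lt_pi_div_two.2 h0⟩,
        cos_arccos (by linarith) h1.le⟩
  rw [integral_of_le zero_le_one, integral_of_le pi_div_two_pos.le,
    integral_Ioc_eq_integral_Ioo, integral_Ioc_eq_integral_Ioo, ← himg,
    integral_image_eq_integral_abs_deriv_smul measurableSet_Ioo
      (fun θ _ => (hasDerivAt_cos θ).hasDerivWithinAt)
      (injOn_cos.mono (Ioo_subset_Icc_self.trans (Icc_subset_Icc_right (by linarith [pi_pos]))))]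
  refine setIntegral_congr_fun measurableSet_Ioo fun θ hθ => ?_
  have hs : 0 < sin θ := sin_pos_of_pos_of_lt_pi hθ.1 (by linarith [hθ.2, pi_pos])
  have hsq : √(1 - cos θ ^ 2) = sin θ := by
    rw [← sin_sq, sqrt_sq hs.le]
  simp only [hsq, abs_neg, abs_of_pos hs, smul_eq_mul]
  field_simp

lemma one_sub_sq_mul_integral_cos_mul_cos (n : ℕ) :
    (1 - (2 * (n : ℝ)) ^ 2) * ∫ θ in (0 : ℝ)..(π / 2), cos θ * cos (2 * n * θ) =
      (-1) ^ n := by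
  have hderiv (θ : ℝ) : HasDerivAt
      (fun θ => sin θ * cos (2 * n * θ) - 2 * n * (cos θ * sin (2 * n * θ)))
      ((1 - (2 * (n : ℝ)) ^ 2) * (cos θ * cos (2 * n * θ))) θ := by
    have hm := (hasDerivAt_id θ).const_mul (2 * (n : ℝ))
    convert! ((hasDerivAt_sin θ).mul hm.cos).sub
      (((hasDerivAt_cos θ).mul hm.sin).const_mul (2 * (n : ℝ))) using 1
    simp only [id]
    ring
  have hπ : 2 * (n : ℝ) * (π / 2) = n * π := by ring
  rw [← intervalIntegral.integral_const_mul, integral_eq_sub_of_hasDerivAt (fun θ _ => hderiv θ)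
    (Continuous.intervalIntegrable (by fun_prop) _ _)]
  simp [hπ, cos_nat_mul_pi]

lemma sq_sub_sq_mul_integral_cos_pow_mul_cos (n q : ℕ) :
    (((q : ℝ) + 2) ^ 2 - (2 * (n : ℝ)) ^ 2) *
        ∫ θ in (0 : ℝ)..(π / 2), cos θ ^ (q + 2) * cos (2 * n * θ) =
      ((q : ℝ) + 2) * (q + 1) * ∫ θ in (0 : ℝ)..(π / 2), cos θ ^ q * cos (2 * n * θ) := by
  have hderiv (θ : ℝ) : HasDerivAt
      (fun θ => ((q : ℝ) + 2) * (cos θ ^ (q + 1) * (sin θ * cos (2 * n * θ))) -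
        2 * n * (cos θ ^ (q + 2) * sin (2 * n * θ)))
      ((((q : ℝ) + 2) ^ 2 - (2 * (n : ℝ)) ^ 2) * (cos θ ^ (q + 2) * cos (2 * n * θ)) -
        ((q : ℝ) + 2) * (q + 1) * (cos θ ^ q * cos (2 * n * θ))) θ := by
    have hm := (hasDerivAt_id θ).const_mul (2 * (n : ℝ))
    convert! ((((hasDerivAt_cos θ).pow (q + 1)).mul ((hasDerivAt_sin θ).mul hm.cos)).const_mul
      ((q : ℝ) + 2)).sub
      ((((hasDerivAt_cos θ).pow (q + 2)).mul hm.sin).const_mul (2 * (n : ℝ))) using 1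
    simp only [id, Pi.mul_apply, Pi.pow_apply, Nat.add_sub_cancel, Nat.cast_add, Nat.cast_one,
      Nat.cast_ofNat, show q + 2 - 1 = q + 1 from rfl]
    linear_combination ((q + 2) * (q + 1) * cos θ ^ q * cos (2 * n * θ)) * sin_sq_add_cos_sq θ
  have h := integral_eq_sub_of_hasDerivAt (a := 0) (b := π / 2) (fun θ _ => hderiv θ)
    (Continuous.intervalIntegrable (by fun_prop) _ _)
  rw [intervalIntegral.integral_sub (Continuous.intervalIntegrable (by fun_prop) _ _)
    (Continuous.intervalIntegrable (by fun_prop) _ _), intervalIntegral.integral_const_mul,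
    intervalIntegral.integral_const_mul] at h
  simpa [sub_eq_zero] using h

lemma odd_sq_sub_even_sq_ne_zero (k n : ℕ) : (2 * (k : ℝ) + 1) ^ 2 - (2 * (n : ℝ)) ^ 2 ≠ 0 := by
  intro h
  have h' : (2 * k + 1) ^ 2 = (2 * n) ^ 2 := by exact_mod_cast sub_eq_zero.1 h
  have := Nat.pow_left_injective two_ne_zero h'
  omega

lemma integral_cos_pow_odd_mul_cos (n k : ℕ) :
    ∫ θ in (0 : ℝ)..(π / 2), cos θ ^ (2 * k + 1) * cos (2 * n * θ) =
      (-1) ^ n * (2 * k + 1).factorial / (4 ^ k * (1 - (2 * (n : ℝ)) ^ 2) *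
        ((ascPochhammer ℝ k).eval ((3 - 2 * (n : ℝ)) / 2) *
          (ascPochhammer ℝ k).eval ((3 + 2 * (n : ℝ)) / 2))) := by
  induction k with
  | zero =>
    have h0 : 1 - (2 * (n : ℝ)) ^ 2 ≠ 0 := by simpa using odd_sq_sub_even_sq_ne_zero 0 n
    have h := one_sub_sq_mul_integral_cos_mul_cos n
    rw [mul_comm, ← eq_div_iff h0] at h
    simpa using h
  | succ k ih =>
    have hk := odd_sq_sub_even_sq_ne_zero (k + 1) n
    have h := sq_sub_sq_mul_integral_cos_pow_mul_cos n (2 * k + 1)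
    have hq : (((2 * k + 1 : ℕ) : ℝ) + 2) ^ 2 - (2 * (n : ℝ)) ^ 2 =
        (2 * ((k + 1 : ℕ) : ℝ) + 1) ^ 2 - (2 * (n : ℝ)) ^ 2 := by push_cast; ring
    rw [hq, mul_comm, ← eq_div_iff hk, ih] at h
    rw [show 2 * (k + 1) + 1 = 2 * k + 1 + 2 by ring, h, ascPochhammer_succ_eval,
      ascPochhammer_succ_eval, Nat.factorial_succ (2 * k + 2), Nat.factorial_succ (2 * k + 1),
      mul_div_assoc', div_div]
    congr 1 <;> push_cast <;> ring

lemma hasSum_integral_sin_cos_mul (t : ℝ) {g : ℝ → ℝ} (hg : Continuous g)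
    (hg1 : ∀ θ, |g θ| ≤ 1) (a b : ℝ) :
    HasSum (fun k : ℕ => (-1) ^ k * t ^ (2 * k + 1) / (2 * k + 1).factorial *
        ∫ θ in a..b, cos θ ^ (2 * k + 1) * g θ)
      (∫ θ in a..b, sin (cos θ * t) * g θ) := by
  simp_rw [← intervalIntegral.integral_const_mul]
  refine hasSum_integral_of_dominated_convergence
    (fun k _ => |t| ^ (2 * k + 1) / (2 * k + 1).factorial)
    (fun k => Continuous.aestronglyMeasurable (by fun_prop)) (fun k => .of_forall fun θ _ => ?_)
    (.of_forall fun _ _ => ?_) intervalIntegrable_const (.of_forall fun θ _ => ?_)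
  · rw [Real.norm_eq_abs, abs_mul, abs_div, abs_mul, abs_mul, abs_pow, abs_pow, abs_pow, abs_neg,
      abs_one, one_pow, one_mul, Nat.abs_cast]
    refine mul_le_of_le_one_right (by positivity) ?_
    exact mul_le_one₀ (pow_le_one₀ (abs_nonneg _) (abs_cos_le_one θ)) (abs_nonneg _) (hg1 θ)
  · exact (summable_pow_div_factorial |t|).comp_injective
      (i := fun k : ℕ => 2 * k + 1) fun i j h => by simpa using h
  · convert! (hasSum_sin (cos θ * t)).mul_right (g θ) using 2 with k
    rw [mul_pow]
    ring

theorem stmt3 (n : ℕ) (t : ℝ) :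
    lommelS0even n t = (-1 : ℝ) ^ n *
      ∫ u in (0:ℝ)..1, Real.sin (u * t) * (Polynomial.Chebyshev.T ℝ (2 * n)).eval u /
        Real.sqrt (1 - u ^ 2) := by
  rw [integral_div_sqrt_one_sub_sq_eq_integral_cos
    fun u => sin (u * t) * (Chebyshev.T ℝ (2 * n)).eval u]
  simp only [Chebyshev.T_real_cos, Int.cast_mul, Int.cast_ofNat, Int.cast_natCast]
  have h := hasSum_integral_sin_cos_mul t (g := fun θ => cos (2 * n * θ)) (by fun_prop)
    (fun θ => abs_cos_le_one _) 0 (π / 2)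
  rw [← h.tsum_eq, lommelS0even, ← tsum_mul_left, ← tsum_mul_left]
  refine tsum_congr fun k => ?_
  have hsign : ((-1 : ℝ) ^ n) * (-1) ^ n = 1 := by rw [← mul_pow]; simp
  have hf : ((2 * k + 1).factorial : ℝ) ≠ 0 := by positivity
  rw [integral_cos_pow_odd_mul_cos, neg_div, neg_pow, div_pow, ← pow_mul]
  calc _ = ((-1) ^ n * (-1) ^ n) * (((2 * k + 1).factorial : ℝ) / (2 * k + 1).factorial) *
        ((-1) ^ k * t ^ (2 * k + 1) / (4 ^ k * (1 - (2 * (n : ℝ)) ^ 2) *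
        ((ascPochhammer ℝ k).eval ((3 - 2 * (n : ℝ)) / 2) *
          (ascPochhammer ℝ k).eval ((3 + 2 * (n : ℝ)) / 2)))) := by
        rw [hsign, div_self hf]
        simp only [div_eq_mul_inv, mul_inv]
        ring
    _ = _ := by
        simp only [div_eq_mul_inv, mul_inv]
        ring
end

section
/- For every natural number n and every real t, the Lommel function satisfies s_{−1,2n+1}(t) = (−1)^{n+1}/(2n+1) · ∫₀¹ cos(u·t)·T_{2n+1}(u)/√(1−u²) du, where T_{2n+1} is the Chebyshev polynomial of the first kind. -/
open Real Polynomial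

/-- Lommel function `s_{-1,2n+1}(t)` via its hypergeometric series
(analytic continuation of `z^{μ+1}/((μ+1)²-ν²)·₁F₂(1;(μ-ν+3)/2,(μ+ν+3)/2;-z²/4)` at
`μ = -1`, `ν = 2n+1`). -/
noncomputable def lommelSneg1odd (n : ℕ) (t : ℝ) : ℝ :=
  (1 / (-((2 * (n : ℝ) + 1) ^ 2))) * ∑' k : ℕ, (-t ^ 2 / 4) ^ k /
    ((ascPochhammer ℝ k).eval ((2 - (2 * (n : ℝ) + 1)) / 2) *
      (ascPochhammer ℝ k).eval ((2 + (2 * (n : ℝ) + 1)) / 2))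

/-- The substitution `u = cos θ` on `[0, 1]`. -/
theorem integral_div_sqrt_one_sub_sq (f : ℝ → ℝ) :
    ∫ u in (0:ℝ)..1, f u / √(1 - u ^ 2) = ∫ θ in (0:ℝ)..(π / 2), f (cos θ) := by
  calc
    ∫ u in (0:ℝ)..1, f u / √(1 - u ^ 2) = ∫ u in (1:ℝ)..0, f u * -(1 / √(1 - u ^ 2)) := by
      rw [intervalIntegral.integral_symm, ← intervalIntegral.integral_neg]
      simp [div_eq_mul_inv]
    _ = ∫ θ in (arccos 1)..(arccos 0), f (cos θ) := by
      rw [← intervalIntegral.integral_comp_mul_deriv_of_deriv_nonpos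
        (f' := fun x => -(1 / √(1 - x ^ 2)))]
      · simp_rw [Function.comp_apply]
        refine intervalIntegral.integral_congr fun x hx => ?_
        rw [Set.uIcc_of_ge zero_le_one] at hx
        simp [cos_arccos (x := x) (by linarith [hx.1]) hx.2]
      · fun_prop
      · intro x hx
        simp only [zero_le_one, inf_of_le_right, sup_of_le_left, Set.mem_Ioo] at hx
        exact hasDerivAt_arccos (by linarith) (by linarith)
      · simp
    _ = ∫ θ in (0:ℝ)..(π / 2), f (cos θ) := by simp

theorem integral_cos_odd_mul (n : ℕ) :
    ∫ θ in (0:ℝ)..(π / 2), cos ((2 * n + 1) * θ) = (-1) ^ n / (2 * n + 1) := by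
  have h : (2 * (n : ℝ) + 1) ≠ 0 := by positivity
  rw [intervalIntegral.integral_comp_mul_left (fun x => cos x) h, integral_cos,
    show (2 * (n : ℝ) + 1) * (π / 2) = π / 2 + n * π by ring, sin_add_nat_mul_pi]
  simp
  ring

theorem integral_cos_pow_mul_cos_mul_succ (k : ℕ) (m : ℝ) :
    ((2 * k + 2) ^ 2 - m ^ 2) *
        ∫ θ in (0:ℝ)..(π / 2), cos θ ^ (2 * (k + 1)) * cos (m * θ) =
      (2 * k + 2) * (2 * k + 1) * ∫ θ in (0:ℝ)..(π / 2), cos θ ^ (2 * k) * cos (m * θ) := by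
  have hderiv (θ : ℝ) : HasDerivAt
      (fun θ => -(2 * k + 2) * (cos θ ^ (2 * k + 1) * sin θ) * cos (m * θ)
        + m * (cos θ ^ (2 * k + 2) * sin (m * θ)))
      ((2 * k + 2) * (2 * k + 1) * (cos θ ^ (2 * k) * cos (m * θ))
        - ((2 * k + 2) ^ 2 - m ^ 2) * (cos θ ^ (2 * (k + 1)) * cos (m * θ))) θ := by
    have hm : HasDerivAt (fun θ : ℝ => m * θ) m θ := by
      simpa using (hasDerivAt_id θ).const_mul m
    have hc := hasDerivAt_cos θ
    have h := ((((hc.pow (2 * k + 1)).mul (hasDerivAt_sin θ)).const_mul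
      (-(2 * (k : ℝ) + 2))).mul hm.cos).add (((hc.pow (2 * k + 2)).mul hm.sin).const_mul m)
    refine h.congr_deriv ?_
    simp only [Pi.mul_apply, Pi.pow_apply, Nat.add_sub_cancel,
      show 2 * k + 2 - 1 = 2 * k + 1 by lia]
    push_cast
    linear_combination (2 * (k : ℝ) + 2) * (2 * k + 1) * cos θ ^ (2 * k) * cos (m * θ) *
      sin_sq_add_cos_sq θ
  have hint (j : ℕ) (c : ℝ) : IntervalIntegrable
      (fun θ => c * (cos θ ^ j * cos (m * θ))) MeasureTheory.volume 0 (π / 2) :=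
    Continuous.intervalIntegrable (by fun_prop) _ _
  have h := intervalIntegral.integral_eq_sub_of_hasDerivAt (a := 0) (b := π / 2)
    (fun θ _ => hderiv θ) ((hint _ _).sub (hint _ _))
  rw [intervalIntegral.integral_sub (hint _ _) (hint _ _),
    intervalIntegral.integral_const_mul, intervalIntegral.integral_const_mul] at h
  simp only [cos_pi_div_two, sin_zero, mul_zero] at h
  simp at h
  linarith

theorem even_sq_sub_odd_sq_ne_zero (k n : ℕ) :
    (2 * (k : ℝ) + 2) ^ 2 - (2 * n + 1) ^ 2 ≠ 0 := by
  have h : ((2 * (k : ℤ) + 2) ^ 2 - (2 * n + 1) ^ 2) ≠ 0 := by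
    intro h
    ring_nf at h
    lia
  exact_mod_cast h

theorem integral_cos_series_term (n k : ℕ) (t : ℝ) :
    ∫ θ in (0:ℝ)..(π / 2), (-1) ^ k * (cos θ * t) ^ (2 * k) / (2 * k).factorial *
        cos ((2 * n + 1) * θ) =
      (-1) ^ n / (2 * n + 1) * ((-t ^ 2 / 4) ^ k /
        ((ascPochhammer ℝ k).eval ((2 - (2 * (n : ℝ) + 1)) / 2) *
          (ascPochhammer ℝ k).eval ((2 + (2 * (n : ℝ) + 1)) / 2))) := by
  have hfactor (k : ℕ) : ∫ θ in (0:ℝ)..(π / 2), (-1) ^ k * (cos θ * t) ^ (2 * k) /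
      (2 * k).factorial * cos ((2 * n + 1) * θ) = (-1) ^ k * t ^ (2 * k) / (2 * k).factorial *
        ∫ θ in (0:ℝ)..(π / 2), cos θ ^ (2 * k) * cos ((2 * n + 1) * θ) := by
    rw [← intervalIntegral.integral_const_mul]
    congr 1 with θ
    ring
  rw [hfactor]
  induction k with
  | zero => simp [integral_cos_odd_mul]
  | succ k ih =>
    have hne := even_sq_sub_odd_sq_ne_zero k n
    have hrec := integral_cos_pow_mul_cos_mul_succ k (2 * n + 1)
    have hI : ∫ θ in (0:ℝ)..(π / 2), cos θ ^ (2 * (k + 1)) * cos ((2 * n + 1) * θ) =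
        (2 * k + 2) * (2 * k + 1) / ((2 * k + 2) ^ 2 - (2 * n + 1) ^ 2) *
          ∫ θ in (0:ℝ)..(π / 2), cos θ ^ (2 * k) * cos ((2 * n + 1) * θ) := by
      rw [div_mul_eq_mul_div, eq_div_iff hne, ← hrec]
      ring
    have hfac : ((2 * (k + 1)).factorial : ℝ) =
        (2 * k + 2) * (2 * k + 1) * (2 * k).factorial := by
      rw [show 2 * (k + 1) = 2 * k + 1 + 1 by ring, Nat.factorial_succ, Nat.factorial_succ]
      push_cast
      ring
    have hpoch : (ascPochhammer ℝ (k + 1)).eval ((2 - (2 * (n : ℝ) + 1)) / 2) *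
          (ascPochhammer ℝ (k + 1)).eval ((2 + (2 * (n : ℝ) + 1)) / 2) =
        (ascPochhammer ℝ k).eval ((2 - (2 * (n : ℝ) + 1)) / 2) *
          (ascPochhammer ℝ k).eval ((2 + (2 * (n : ℝ) + 1)) / 2) *
          (((2 * k + 2) ^ 2 - (2 * n + 1) ^ 2) / 4) := by
      rw [ascPochhammer_succ_eval, ascPochhammer_succ_eval]
      ring
    calc
      _ = (-1) ^ k * t ^ (2 * k) / (2 * k).factorial *
            (∫ θ in (0:ℝ)..(π / 2), cos θ ^ (2 * k) * cos ((2 * n + 1) * θ)) *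
            (-t ^ 2 / ((2 * k + 2) ^ 2 - (2 * n + 1) ^ 2)) := by
        rw [hI, hfac]
        field_simp
        ring
      _ = _ := by
        rw [ih, hpoch, pow_succ (-t ^ 2 / 4), mul_div_mul_comm, ← mul_assoc]
        congr 1
        field_simp

theorem hasSum_integral_cos_mul_cos (t m : ℝ) :
    HasSum (fun k : ℕ => ∫ θ in (0:ℝ)..(π / 2),
        (-1) ^ k * (cos θ * t) ^ (2 * k) / (2 * k).factorial * cos (m * θ))
      (∫ θ in (0:ℝ)..(π / 2), cos (cos θ * t) * cos (m * θ)) := by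
  refine intervalIntegral.hasSum_integral_of_dominated_convergence
    (fun k _ => |t| ^ (2 * k) / (2 * k).factorial) (fun k => ?_) (fun k => ?_) ?_ ?_ ?_
  · exact Continuous.aestronglyMeasurable (by fun_prop)
  · refine .of_forall fun θ _ => ?_
    rw [Real.norm_eq_abs, abs_mul, abs_div, abs_mul, abs_pow, abs_pow, abs_mul, Nat.abs_cast,
      abs_neg, abs_one, one_pow, one_mul]
    refine (mul_le_of_le_one_right (by positivity) (abs_cos_le_one _)).trans ?_
    gcongr
    exact mul_le_of_le_one_left (abs_nonneg t) (abs_cos_le_one _)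
  · exact .of_forall fun _ _ => (Real.hasSum_cosh |t|).summable
  · exact intervalIntegrable_const
  · exact .of_forall fun θ _ => (Real.hasSum_cos (cos θ * t)).mul_right _

theorem stmt4 (n : ℕ) (t : ℝ) :
    lommelSneg1odd n t = (-1 : ℝ) ^ (n + 1) / (2 * (n : ℝ) + 1) *
      ∫ u in (0:ℝ)..1, Real.cos (u * t) * (Polynomial.Chebyshev.T ℝ (2 * n + 1)).eval u /
        Real.sqrt (1 - u ^ 2) := by
  have hsum := (hasSum_integral_cos_mul_cos t (2 * n + 1)).tsum_eq
  simp_rw [integral_cos_series_term, tsum_mul_left] at hsum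
  have hT (θ : ℝ) : (Polynomial.Chebyshev.T ℝ (2 * n + 1)).eval (cos θ) =
      cos ((2 * n + 1) * θ) := by
    rw [Polynomial.Chebyshev.T_real_cos]
    push_cast
    rfl
  rw [integral_div_sqrt_one_sub_sq
    (fun u => cos (u * t) * (Polynomial.Chebyshev.T ℝ (2 * n + 1)).eval u)]
  simp_rw [hT]
  rw [← hsum, lommelSneg1odd, ← mul_assoc]
  congr 1
  have h1 : ((-1 : ℝ) ^ n) * (-1) ^ n = 1 := by rw [← mul_pow]; simp
  field_simp
  rw [pow_succ]
  linear_combination h1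
end
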